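/- arXiv:2303.08428 — 5 statements merged into one kernel-verified Lean document; each statement's English description precedes it below -/
import Mathlib

section
/- Let A ∈ ℝ^{n×n} be invertible and let (x_t), (u_t), and real numbers ω_t^τ be sequences satisfying the recursion x_{t+1} = A x_t + Σ_{τ=0}^{D} (B_τ + ω_t^τ C_τ) u_{t-τ} for all t ≥ 0. Define η_t = x_t + Σ_{τ=1}^{D} [Σ_{j=τ}^{D} A^{τ-j-1}(B_j + ω_{t+j-τ}^j C_j)] u_{t-τ}. Then for all t ≥ 0, η_{t+1} = A η_t + Σ_{j=0}^{D} A^{-j}(B_j + ω_{t+j}^j C_j) u_t. -/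
open Matrix Finset

/-- A triangular sum split off along its diagonal equals the same sum split off along its first
row. -/
theorem sum_diagonal_add_sum_above_diagonal {M : Type*} [AddCommMonoid M] (D : ℕ)
    (G : ℕ → ℕ → M) :
    ∑ σ ∈ range (D + 1), G σ σ + ∑ τ ∈ Icc 1 D, ∑ j ∈ Icc τ D, G (τ - 1) j =
      ∑ σ ∈ Icc 1 D, ∑ j ∈ Icc σ D, G σ j + ∑ j ∈ range (D + 1), G 0 j := by
  have hshift (f : ℕ → M) : ∑ τ ∈ Icc 1 D, f τ = ∑ σ ∈ range D, f (σ + 1) := by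
    rw [range_eq_Ico, sum_Ico_add' f 0 D 1]
    rfl
  have hfull : ∑ σ ∈ range (D + 1), ∑ j ∈ Icc σ D, G σ j =
      ∑ σ ∈ range (D + 1), G σ σ + ∑ σ ∈ range D, ∑ j ∈ Icc (σ + 1) D, G σ j := by
    have hrow : ∀ σ ∈ range (D + 1),
        ∑ j ∈ Icc σ D, G σ j = G σ σ + ∑ j ∈ Icc (σ + 1) D, G σ j := by
      intro σ hσ
      have hIoc : Icc (σ + 1) D = Ioc σ D := by ext; simp
      rw [← add_sum_Ioc_eq_sum_Icc (mem_range_succ_iff.mp hσ), hIoc]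
    rw [sum_congr rfl hrow, sum_add_distrib, sum_range_succ (fun σ => ∑ j ∈ Icc (σ + 1) D, G σ j)]
    simp
  rw [hshift, hshift]
  simp only [Nat.add_sub_cancel]
  rw [← hfull, sum_range_succ']
  congr 1
  rw [range_eq_Ico]
  rfl

/-- pathwise reduction identity.
If `x_{t+1} = A x_t + Σ_{τ=0}^{D} (B_τ + ω_t^τ C_τ) u_{t-τ}` with `A` invertible, and
`η_t = x_t + Σ_{τ=1}^{D} [Σ_{j=τ}^{D} A^{τ-j-1}(B_j + ω_{t+j-τ}^j C_j)] u_{t-τ}`, then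
`η_{t+1} = A η_t + Σ_{j=0}^{D} A^{-j}(B_j + ω_{t+j}^j C_j) u_t`. -/
theorem stmt_6 {n m D : ℕ}
    (A : Matrix (Fin n) (Fin n) ℝ) (hA : IsUnit A.det)
    (B C : ℕ → Matrix (Fin n) (Fin m) ℝ)
    (ω : ℕ → ℕ → ℝ)
    (x : ℕ → Fin n → ℝ) (u : ℤ → Fin m → ℝ)
    (hdyn : ∀ t : ℕ, x (t + 1) =
      A.mulVec (x t) + ∑ τ ∈ Finset.range (D + 1),
        (B τ + ω t τ • C τ).mulVec (u ((t : ℤ) - τ)))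
    (η : ℕ → Fin n → ℝ)
    (hη : ∀ t : ℕ, η t = x t + ∑ τ ∈ Finset.Icc 1 D, ∑ j ∈ Finset.Icc τ D,
        ((A ^ ((τ : ℤ) - j - 1)) * (B j + ω (t + j - τ) j • C j)).mulVec (u ((t : ℤ) - τ))) :
    ∀ t : ℕ, η (t + 1) =
      A.mulVec (η t) + ∑ j ∈ Finset.range (D + 1),
        ((A ^ (-(j : ℤ))) * (B j + ω (t + j) j • C j)).mulVec (u (t : ℤ)) := by
  intro t
  let G : ℕ → ℕ → Fin n → ℝ := fun σ j =>
    (A ^ ((σ : ℤ) - j) * (B j + ω (t + j - σ) j • C j)) *ᵥ u ((t : ℤ) - σ)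
  have hdiag : ∀ σ ∈ range (D + 1), (B σ + ω t σ • C σ) *ᵥ u ((t : ℤ) - σ) = G σ σ := by
    intro σ _
    simp [G]
  have hnext : ∀ τ ∈ Icc 1 D, ∑ j ∈ Icc τ D,
      (A ^ ((τ : ℤ) - j - 1) * (B j + ω (t + 1 + j - τ) j • C j)) *ᵥ u (((t + 1 : ℕ) : ℤ) - τ) =
        ∑ j ∈ Icc τ D, G (τ - 1) j := by
    intro τ hτ
    obtain ⟨σ, rfl⟩ := Nat.exists_eq_add_of_le' (mem_Icc.mp hτ).1
    refine sum_congr rfl fun j _ => ?_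
    have hpow : ((σ + 1 : ℕ) : ℤ) - j - 1 = σ - j := by push_cast; ring
    have htime : t + 1 + j - (σ + 1) = t + j - σ := by omega
    have hinput : ((t + 1 : ℕ) : ℤ) - (σ + 1 : ℕ) = t - σ := by push_cast; ring
    simp only [G, hpow, htime, hinput, Nat.add_sub_cancel]
  have hcurr : A *ᵥ (∑ τ ∈ Icc 1 D, ∑ j ∈ Icc τ D,
      (A ^ ((τ : ℤ) - j - 1) * (B j + ω (t + j - τ) j • C j)) *ᵥ u ((t : ℤ) - τ)) =
        ∑ τ ∈ Icc 1 D, ∑ j ∈ Icc τ D, G τ j := by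
    simp only [mulVec_sum]
    refine sum_congr rfl fun τ _ => sum_congr rfl fun j _ => ?_
    rw [mulVec_mulVec, ← Matrix.mul_assoc, ← zpow_one_add hA, add_sub_cancel]
  have hfirst : ∀ j ∈ range (D + 1),
      (A ^ (-(j : ℤ)) * (B j + ω (t + j) j • C j)) *ᵥ u (t : ℤ) = G 0 j := by
    intro j _
    simp [G]
  rw [hη (t + 1), hη t, hdyn, mulVec_add, hcurr, sum_congr rfl hdiag, sum_congr rfl hnext,
    sum_congr rfl hfirst, add_assoc, add_assoc, sum_diagonal_add_sum_above_diagonal]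
end

section
/- Let A ∈ ℝ^{n×n} be invertible and Q, R symmetric positive definite. A symmetric positive definite matrix Z satisfies the DDARE -Z + A'ZA + Q - A'Z L Ψ^{-1} L' Z A = 0 (with L = Σ_{j=0}^{D} A^{D-j} B_j, Ψ = L'ZL + Σ_{τ=0}^{D} σ_τ² C_τ'(A')^D Z A^D C_τ + U_{R,Q}, U_{R,Q} = R + Σ_{τ=1}^{D} Σ_{h=1}^{τ} σ_τ² C_τ'(A')^{D-h} Q A^{D-h} C_τ) if and only if the symmetric positive definite matrix P = (A')^D Z A^D satisfies the equivalent DDARE -P + A'PA + Q̂ - A'P H Λ^{-1} H' P A = 0, where Q̂ = (A')^D Q A^D, H = Σ_{j=0}^{D} A^{-j} B_j, and Λ = H'PH + Σ_{τ=0}^{D} σ_τ² C_τ' P C_τ + W_{R,Q̂} with W_{R,Q̂} = R + Σ_{τ=1}^{D} Σ_{h=1}^{τ} σ_τ² C_τ'(A')^{-h} Q̂ A^{-h} C_τ. -/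
open Matrix

noncomputable section

/-- `L = Σ_{j=0}^{D} A^{D-j} B_j`. -/
def Lmat {n m D : ℕ} (A : Matrix (Fin n) (Fin n) ℝ)
    (B : Fin (D + 1) → Matrix (Fin n) (Fin m) ℝ) : Matrix (Fin n) (Fin m) ℝ :=
  ∑ j : Fin (D + 1), A ^ (D - (j : ℕ)) * B j

/-- `H = Σ_{j=0}^{D} A^{-j} B_j`. -/
def Hmat {n m D : ℕ} (A : Matrix (Fin n) (Fin n) ℝ)
    (B : Fin (D + 1) → Matrix (Fin n) (Fin m) ℝ) : Matrix (Fin n) (Fin m) ℝ :=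
  ∑ j : Fin (D + 1), A ^ (-((j : ℕ) : ℤ)) * B j

/-- `U_{R,Q} = R + Σ_{τ=1}^{D} Σ_{h=1}^{τ} σ_τ² C_τ'(A')^{D-h} Q A^{D-h} C_τ`. -/
def Umat {n m D : ℕ} (A : Matrix (Fin n) (Fin n) ℝ)
    (C : Fin (D + 1) → Matrix (Fin n) (Fin m) ℝ) (σ : Fin (D + 1) → ℝ)
    (Q : Matrix (Fin n) (Fin n) ℝ) (R : Matrix (Fin m) (Fin m) ℝ) :
    Matrix (Fin m) (Fin m) ℝ :=
  R + ∑ τ : Fin (D + 1), ∑ h ∈ Finset.Icc 1 (τ : ℕ),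
    (σ τ) ^ 2 • ((C τ)ᵀ * (Aᵀ) ^ (D - h) * Q * A ^ (D - h) * C τ)

/-- `Ψ = L'ZL + Σ_{τ=0}^{D} σ_τ² C_τ'(A')^D Z A^D C_τ + U_{R,Q}`. -/
def Psimat {n m D : ℕ} (A : Matrix (Fin n) (Fin n) ℝ)
    (B C : Fin (D + 1) → Matrix (Fin n) (Fin m) ℝ) (σ : Fin (D + 1) → ℝ)
    (Q : Matrix (Fin n) (Fin n) ℝ) (R : Matrix (Fin m) (Fin m) ℝ)
    (Z : Matrix (Fin n) (Fin n) ℝ) : Matrix (Fin m) (Fin m) ℝ :=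
  (Lmat A B)ᵀ * Z * Lmat A B +
    (∑ τ : Fin (D + 1), (σ τ) ^ 2 • ((C τ)ᵀ * (Aᵀ) ^ D * Z * A ^ D * C τ)) +
    Umat A C σ Q R

/-- `W_{R,Q̂} = R + Σ_{τ=1}^{D} Σ_{h=1}^{τ} σ_τ² C_τ'(A')^{-h} Q̂ A^{-h} C_τ`. -/
def Wmat {n m D : ℕ} (A : Matrix (Fin n) (Fin n) ℝ)
    (C : Fin (D + 1) → Matrix (Fin n) (Fin m) ℝ) (σ : Fin (D + 1) → ℝ)
    (Qhat : Matrix (Fin n) (Fin n) ℝ) (R : Matrix (Fin m) (Fin m) ℝ) :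
    Matrix (Fin m) (Fin m) ℝ :=
  R + ∑ τ : Fin (D + 1), ∑ h ∈ Finset.Icc 1 (τ : ℕ),
    (σ τ) ^ 2 • ((C τ)ᵀ * (Aᵀ) ^ (-(h : ℤ)) * Qhat * A ^ (-(h : ℤ)) * C τ)

/-- `Λ = H'PH + Σ_{τ=0}^{D} σ_τ² C_τ' P C_τ + W_{R,Q̂}`. -/
def Lambdamat {n m D : ℕ} (A : Matrix (Fin n) (Fin n) ℝ)
    (B C : Fin (D + 1) → Matrix (Fin n) (Fin m) ℝ) (σ : Fin (D + 1) → ℝ)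
    (Qhat : Matrix (Fin n) (Fin n) ℝ) (R : Matrix (Fin m) (Fin m) ℝ)
    (P : Matrix (Fin n) (Fin n) ℝ) : Matrix (Fin m) (Fin m) ℝ :=
  (Hmat A B)ᵀ * P * Hmat A B +
    (∑ τ : Fin (D + 1), (σ τ) ^ 2 • ((C τ)ᵀ * P * C τ)) +
    Wmat A C σ Qhat R

theorem pow_mul_zpow_neg {n D h : ℕ} {A : Matrix (Fin n) (Fin n) ℝ} (hA : IsUnit A.det)
    (hh : h ≤ D) : A ^ D * A ^ (-(h : ℤ)) = A ^ (D - h) := by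
  rw [← zpow_natCast A D, ← Matrix.zpow_add hA, ← zpow_natCast A (D - h)]
  congr 1
  omega

theorem zpow_neg_mul_pow {n D h : ℕ} {A : Matrix (Fin n) (Fin n) ℝ} (hA : IsUnit A.det)
    (hh : h ≤ D) : A ^ (-(h : ℤ)) * A ^ D = A ^ (D - h) := by
  rw [← zpow_natCast A D, ← Matrix.zpow_add hA, ← zpow_natCast A (D - h)]
  congr 1
  omega

theorem pow_mul_Hmat {n m D : ℕ} {A : Matrix (Fin n) (Fin n) ℝ} (hA : IsUnit A.det)
    (B : Fin (D + 1) → Matrix (Fin n) (Fin m) ℝ) : A ^ D * Hmat A B = Lmat A B := by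
  simp only [Hmat, Lmat, Matrix.mul_sum]
  refine Finset.sum_congr rfl fun j _ => ?_
  rw [← Matrix.mul_assoc, pow_mul_zpow_neg hA (Nat.le_of_lt_succ j.isLt)]

theorem Hmat_transpose_mul_pow {n m D : ℕ} {A : Matrix (Fin n) (Fin n) ℝ} (hA : IsUnit A.det)
    (B : Fin (D + 1) → Matrix (Fin n) (Fin m) ℝ) :
    (Hmat A B)ᵀ * (Aᵀ) ^ D = (Lmat A B)ᵀ := by
  rw [← pow_mul_Hmat hA, Matrix.transpose_mul, Matrix.transpose_pow]

theorem Wmat_conj {n m D : ℕ} {A : Matrix (Fin n) (Fin n) ℝ} (hA : IsUnit A.det)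
    (C : Fin (D + 1) → Matrix (Fin n) (Fin m) ℝ) (σ : Fin (D + 1) → ℝ)
    (Q : Matrix (Fin n) (Fin n) ℝ) (R : Matrix (Fin m) (Fin m) ℝ) :
    Wmat A C σ ((Aᵀ) ^ D * Q * A ^ D) R = Umat A C σ Q R := by
  have hAt : IsUnit (Aᵀ).det := by rwa [Matrix.det_transpose]
  unfold Wmat Umat
  congr 1
  refine Finset.sum_congr rfl fun τ _ => Finset.sum_congr rfl fun h hh => ?_
  have hD : h ≤ D := (Finset.mem_Icc.mp hh).2.trans (Nat.le_of_lt_succ τ.isLt)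
  rw [← pow_mul_zpow_neg hA hD, ← zpow_neg_mul_pow hAt hD]
  simp only [Matrix.mul_assoc]

theorem Lambdamat_conj {n m D : ℕ} {A : Matrix (Fin n) (Fin n) ℝ} (hA : IsUnit A.det)
    (B C : Fin (D + 1) → Matrix (Fin n) (Fin m) ℝ) (σ : Fin (D + 1) → ℝ)
    (Q : Matrix (Fin n) (Fin n) ℝ) (R : Matrix (Fin m) (Fin m) ℝ)
    (Z : Matrix (Fin n) (Fin n) ℝ) :
    Lambdamat A B C σ ((Aᵀ) ^ D * Q * A ^ D) R ((Aᵀ) ^ D * Z * A ^ D) =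
      Psimat A B C σ Q R Z := by
  unfold Lambdamat Psimat
  rw [Wmat_conj hA, ← Hmat_transpose_mul_pow hA, ← pow_mul_Hmat hA]
  simp only [Matrix.mul_assoc]

/-- equivalent form of the DDARE.
For invertible `A` and positive definite `Q`, `R`, a positive definite `Z` solves
`-Z + A'ZA + Q - A'Z L Ψ^{-1} L' Z A = 0` iff the positive definite matrix
`P = (A')^D Z A^D` solves `-P + A'PA + Q̂ - A'P H Λ^{-1} H' P A = 0`,
where `Q̂ = (A')^D Q A^D`. -/
theorem stmt_8 {n m D : ℕ}
    (A : Matrix (Fin n) (Fin n) ℝ) (hA : IsUnit A.det)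
    (B C : Fin (D + 1) → Matrix (Fin n) (Fin m) ℝ) (σ : Fin (D + 1) → ℝ)
    (Q : Matrix (Fin n) (Fin n) ℝ) (R : Matrix (Fin m) (Fin m) ℝ)
    (hQ : Q.PosDef) (hR : R.PosDef)
    (Z : Matrix (Fin n) (Fin n) ℝ) (hZ : Z.PosDef) :
    ((Aᵀ) ^ D * Z * A ^ D).PosDef ∧
    (-Z + Aᵀ * Z * A + Q -
        Aᵀ * Z * Lmat A B * (Psimat A B C σ Q R Z)⁻¹ * (Lmat A B)ᵀ * Z * A = 0 ↔
      -((Aᵀ) ^ D * Z * A ^ D) + Aᵀ * ((Aᵀ) ^ D * Z * A ^ D) * A + (Aᵀ) ^ D * Q * A ^ D -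
        Aᵀ * ((Aᵀ) ^ D * Z * A ^ D) * Hmat A B *
          (Lambdamat A B C σ ((Aᵀ) ^ D * Q * A ^ D) R ((Aᵀ) ^ D * Z * A ^ D))⁻¹ *
          (Hmat A B)ᵀ * ((Aᵀ) ^ D * Z * A ^ D) * A = 0) := by
  have hU : IsUnit A := (Matrix.isUnit_iff_isUnit_det A).mpr hA
  have hUD : IsUnit (A ^ D) := hU.pow D
  have hUtD : IsUnit ((Aᵀ) ^ D) := ((Matrix.isUnit_transpose A).mpr hU).pow D
  refine ⟨?_, ?_⟩
  · have h := hZ.conjTranspose_mul_mul_same (Matrix.mulVec_injective_of_isUnit hUD)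
    rwa [Matrix.conjTranspose_eq_transpose_of_trivial, Matrix.transpose_pow] at h
  · rw [Lambdamat_conj hA]
    set K := (Psimat A B C σ Q R Z)⁻¹
    have key : -((Aᵀ) ^ D * Z * A ^ D) + Aᵀ * ((Aᵀ) ^ D * Z * A ^ D) * A +
        (Aᵀ) ^ D * Q * A ^ D - Aᵀ * ((Aᵀ) ^ D * Z * A ^ D) * Hmat A B * K *
          (Hmat A B)ᵀ * ((Aᵀ) ^ D * Z * A ^ D) * A =
        (Aᵀ) ^ D * (-Z + Aᵀ * Z * A + Q -
          Aᵀ * Z * Lmat A B * K * (Lmat A B)ᵀ * Z * A) * A ^ D := by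
      have hc : A ^ D * A = A * A ^ D := (Commute.self_pow A D).eq.symm
      have hct (X : Matrix (Fin n) (Fin n) ℝ) : (Aᵀ) ^ D * (Aᵀ * X) = Aᵀ * ((Aᵀ) ^ D * X) := by
        rw [← Matrix.mul_assoc, ← Matrix.mul_assoc, (Commute.self_pow Aᵀ D).eq]
      rw [← Hmat_transpose_mul_pow hA, ← pow_mul_Hmat hA]
      simp only [Matrix.mul_add, Matrix.add_mul, Matrix.mul_sub, Matrix.sub_mul,
        Matrix.mul_neg, Matrix.neg_mul, Matrix.mul_assoc, hc, hct]
    rw [key, hUD.mul_left_eq_zero, hUtD.mul_right_eq_zero]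
end
end

section
/- Define the Riccati operator R^R_D(Z) = A'ZA + Q - A'Z B̄ Ψ^R_D(Z)^{-1} B̄' Z A with Ψ^R_D(Z) = B̄'ZB̄ + σ_0² C_0'(A')^D Z A^D C_0 + σ_D² C̄'(A')^D Z A^D C̄ + Σ_{h=1}^{D} σ_D² C̄'(A')^{D-h} Q A^{D-h} C̄ + R, for symmetric positive definite Q, R. Suppose Z_0 is symmetric positive semidefinite with Z_0 ⪰ R^R_D(Z_0), and define Z_{k+1} = R^R_D(Z_k). Then the sequence (Z_k) is monotone nonincreasing in the Loewner order, satisfies Z_k ⪰ Q > 0 for all k ≥ 1, and converges to a symmetric positive definite matrix Ẑ satisfying Ẑ = R^R_D(Ẑ). -/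
open Matrix Filter

noncomputable section

/-- `Ψ^R_D(Z) = B̄'ZB̄ + σ_0² C_0'(A')^D Z A^D C_0 + σ_D² C̄'(A')^D Z A^D C̄
  + Σ_{h=1}^{D} σ_D² C̄'(A')^{D-h} Q A^{D-h} C̄ + R`. -/
def PsiR {n : ℕ} (A Bb C0 Cb : Matrix (Fin n) (Fin n) ℝ) (σ0 σD : ℝ)
    (Q : Matrix (Fin n) (Fin n) ℝ) (D : ℕ) (R Z : Matrix (Fin n) (Fin n) ℝ) :
    Matrix (Fin n) (Fin n) ℝ :=
  Bbᵀ * Z * Bb + σ0 ^ 2 • (C0ᵀ * (Aᵀ) ^ D * Z * A ^ D * C0) +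
    σD ^ 2 • (Cbᵀ * (Aᵀ) ^ D * Z * A ^ D * Cb) +
    (∑ h ∈ Finset.Icc 1 D, σD ^ 2 • (Cbᵀ * (Aᵀ) ^ (D - h) * Q * A ^ (D - h) * Cb)) + R

/-- The Riccati operator `R^R_D(Z) = A'ZA + Q - A'Z B̄ Ψ^R_D(Z)^{-1} B̄' Z A` of the
restricted system `[A,C_0;B̄,C̄]_D`. -/
def RopR {n : ℕ} (A Bb C0 Cb : Matrix (Fin n) (Fin n) ℝ) (σ0 σD : ℝ)
    (Q : Matrix (Fin n) (Fin n) ℝ) (D : ℕ) (R Z : Matrix (Fin n) (Fin n) ℝ) :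
    Matrix (Fin n) (Fin n) ℝ :=
  Aᵀ * Z * A + Q - Aᵀ * Z * Bb * (PsiR A Bb C0 Cb σ0 σD Q D R Z)⁻¹ * Bbᵀ * Z * A

section LoewnerLimits

variable {ι : Type*}

lemma Matrix.PosSemidef.transpose_eq {M : Matrix ι ι ℝ} (hM : M.PosSemidef) : Mᵀ = M := by
  simpa only [conjTranspose_eq_transpose_of_trivial] using hM.isHermitian.eq

variable [Fintype ι]

lemma Matrix.PosSemidef.transpose_mul_mul_same {M : Matrix ι ι ℝ} (hM : M.PosSemidef)
    (B : Matrix ι ι ℝ) : (Bᵀ * M * B).PosSemidef := by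
  simpa only [conjTranspose_eq_transpose_of_trivial] using hM.conjTranspose_mul_mul_same B

/-- The positive semidefinite matrices form a closed set. -/
lemma Matrix.posSemidef_of_tendsto {Z : ℕ → Matrix ι ι ℝ} {L : Matrix ι ι ℝ}
    (hZ : Tendsto Z atTop (nhds L)) (h : ∀ᶠ k in atTop, (Z k).PosSemidef) : L.PosSemidef := by
  refine .of_dotProduct_mulVec_nonneg ?_ fun x => ?_
  · have ht : Tendsto (fun k => (Z k)ᴴ) atTop (nhds Lᴴ) :=
      ((continuous_id.matrix_conjTranspose).tendsto L).comp hZ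
    refine tendsto_nhds_unique (ht.congr' ?_) hZ
    filter_upwards [h] with k hk using hk.isHermitian
  · have ht : Tendsto (fun k => star x ⬝ᵥ Z k *ᵥ x) atTop (nhds (star x ⬝ᵥ L *ᵥ x)) :=
      ((continuous_const.dotProduct (continuous_id.matrix_mulVec continuous_const)).tendsto L).comp
        hZ
    refine ge_of_tendsto ht ?_
    filter_upwards [h] with k hk using hk.dotProduct_mulVec_nonneg x

/-- A Loewner-nonincreasing sequence of positive semidefinite matrices converges. -/
lemma Matrix.exists_tendsto_of_posSemidef_antitone [DecidableEq ι] {Z : ℕ → Matrix ι ι ℝ}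
    (hpos : ∀ k, (Z k).PosSemidef) (hanti : ∀ k, (Z k - Z (k + 1)).PosSemidef) :
    ∃ L, Tendsto Z atTop (nhds L) := by
  have hquad (x : ι → ℝ) : ∃ l, Tendsto (fun k => x ⬝ᵥ Z k *ᵥ x) atTop (nhds l) := by
    refine ⟨_, tendsto_atTop_ciInf (antitone_nat_of_succ_le fun k => ?_) ⟨0, ?_⟩⟩
    · have := (hanti k).dotProduct_mulVec_nonneg x
      simp only [star_trivial, sub_mulVec, dotProduct_sub] at this
      linarith
    · rintro _ ⟨k, rfl⟩
      simpa using (hpos k).dotProduct_mulVec_nonneg x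
  choose q hq using hquad
  let e (i : ι) : ι → ℝ := Pi.single i 1
  refine ⟨fun i j => (q (e i + e j) - q (e i) - q (e j)) / 2, ?_⟩
  refine tendsto_pi_nhds.2 fun i => tendsto_pi_nhds.2 fun j => ?_
  refine ((((hq (e i + e j)).sub (hq (e i))).sub (hq (e j))).div_const 2).congr fun k => ?_
  have hsymm : Z k j i = Z k i j := by
    conv_rhs => rw [← (hpos k).transpose_eq]
    rfl
  simp only [e, mulVec_add, add_dotProduct, dotProduct_add, mulVec_single_one,
    single_one_dotProduct, col_apply, hsymm]
  ring

end LoewnerLimits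

section Riccati

variable {n : ℕ} {A Bb C0 Cb : Matrix (Fin n) (Fin n) ℝ} {σ0 σD : ℝ} {D : ℕ}
  {Q R X Y Z : Matrix (Fin n) (Fin n) ℝ}

/-- The cost of using the gain `L` for one step, before minimising over `L`. -/
def gainCost (A Bb C0 Cb : Matrix (Fin n) (Fin n) ℝ) (σ0 σD : ℝ) (Q : Matrix (Fin n) (Fin n) ℝ)
    (D : ℕ) (R L Z : Matrix (Fin n) (Fin n) ℝ) : Matrix (Fin n) (Fin n) ℝ :=
  (A + Bb * L)ᵀ * Z * (A + Bb * L) + Q +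
    Lᵀ * (PsiR A Bb C0 Cb σ0 σD Q D R Z - Bbᵀ * Z * Bb) * L

lemma posSemidef_transpose_pow_conj (hZ : Z.PosSemidef) (A C : Matrix (Fin n) (Fin n) ℝ)
    (m : ℕ) : (Cᵀ * Aᵀ ^ m * Z * A ^ m * C).PosSemidef := by
  simpa only [transpose_mul, transpose_pow, mul_assoc] using
    hZ.transpose_mul_mul_same (A ^ m * C)

lemma posDef_PsiR_sub (hQ : Q.PosDef) (hR : R.PosDef) (hZ : Z.PosSemidef) :
    (PsiR A Bb C0 Cb σ0 σD Q D R Z - Bbᵀ * Z * Bb).PosDef := by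
  have h : PsiR A Bb C0 Cb σ0 σD Q D R Z - Bbᵀ * Z * Bb =
      (σ0 ^ 2 • (C0ᵀ * Aᵀ ^ D * Z * A ^ D * C0) + σD ^ 2 • (Cbᵀ * Aᵀ ^ D * Z * A ^ D * Cb) +
        ∑ h ∈ Finset.Icc 1 D, σD ^ 2 • (Cbᵀ * Aᵀ ^ (D - h) * Q * A ^ (D - h) * Cb)) + R := by
    unfold PsiR; abel
  rw [h]
  have h0 := (posSemidef_transpose_pow_conj hZ A C0 D).smul (sq_nonneg σ0)
  have hD := (posSemidef_transpose_pow_conj hZ A Cb D).smul (sq_nonneg σD)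
  have hsum := posSemidef_sum (Finset.Icc 1 D) fun h _ =>
    (posSemidef_transpose_pow_conj hQ.posSemidef A Cb (D - h)).smul (sq_nonneg σD)
  exact PosDef.posSemidef_add ((h0.add hD).add hsum) hR

lemma posDef_PsiR (hQ : Q.PosDef) (hR : R.PosDef) (hZ : Z.PosSemidef) :
    (PsiR A Bb C0 Cb σ0 σD Q D R Z).PosDef := by
  rw [← sub_add_cancel (PsiR A Bb C0 Cb σ0 σD Q D R Z) (Bbᵀ * Z * Bb)]
  exact (posDef_PsiR_sub hQ hR hZ).add_posSemidef (hZ.transpose_mul_mul_same Bb)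

lemma gainCost_mono (h : (Y - X).PosSemidef) (L : Matrix (Fin n) (Fin n) ℝ) :
    (gainCost A Bb C0 Cb σ0 σD Q D R L Y - gainCost A Bb C0 Cb σ0 σD Q D R L X).PosSemidef := by
  have key : gainCost A Bb C0 Cb σ0 σD Q D R L Y - gainCost A Bb C0 Cb σ0 σD Q D R L X =
      (A + Bb * L)ᵀ * (Y - X) * (A + Bb * L) +
        Lᵀ * (σ0 ^ 2 • (C0ᵀ * Aᵀ ^ D * (Y - X) * A ^ D * C0) +
          σD ^ 2 • (Cbᵀ * Aᵀ ^ D * (Y - X) * A ^ D * Cb)) * L := by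
    simp only [gainCost, PsiR, mul_sub, sub_mul, mul_add, add_mul, smul_sub]
    abel
  rw [key]
  refine (h.transpose_mul_mul_same _).add (PosSemidef.transpose_mul_mul_same (.add ?_ ?_) L)
  · exact (posSemidef_transpose_pow_conj h ..).smul (sq_nonneg _)
  · exact (posSemidef_transpose_pow_conj h ..).smul (sq_nonneg _)

lemma gainCost_eq (hQ : Q.PosDef) (hR : R.PosDef) (hZ : Z.PosSemidef)
    (L : Matrix (Fin n) (Fin n) ℝ) :
    gainCost A Bb C0 Cb σ0 σD Q D R L Z = RopR A Bb C0 Cb σ0 σD Q D R Z +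
      (L + (PsiR A Bb C0 Cb σ0 σD Q D R Z)⁻¹ * Bbᵀ * Z * A)ᵀ * PsiR A Bb C0 Cb σ0 σD Q D R Z *
        (L + (PsiR A Bb C0 Cb σ0 σD Q D R Z)⁻¹ * Bbᵀ * Z * A) := by
  have hP : (PsiR A Bb C0 Cb σ0 σD Q D R Z).PosDef := posDef_PsiR hQ hR hZ
  unfold gainCost RopR
  generalize PsiR A Bb C0 Cb σ0 σD Q D R Z = P at hP ⊢
  have hdet := (isUnit_iff_isUnit_det P).1 hP.isUnit
  have hPS (M : Matrix (Fin n) (Fin n) ℝ) : P * (P⁻¹ * M) = M :=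
    mul_nonsing_inv_cancel_left P M hdet
  have hSP (M : Matrix (Fin n) (Fin n) ℝ) : P⁻¹ * (P * M) = M :=
    nonsing_inv_mul_cancel_left P M hdet
  simp only [transpose_add, transpose_mul, transpose_transpose, hZ.transpose_eq,
    hP.inv.posSemidef.transpose_eq, mul_add, add_mul, mul_sub, sub_mul, mul_assoc, hPS, hSP]
  abel

lemma RopR_le_gainCost (hQ : Q.PosDef) (hR : R.PosDef) (hZ : Z.PosSemidef)
    (L : Matrix (Fin n) (Fin n) ℝ) :
    (gainCost A Bb C0 Cb σ0 σD Q D R L Z - RopR A Bb C0 Cb σ0 σD Q D R Z).PosSemidef := by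
  rw [gainCost_eq hQ hR hZ, add_sub_cancel_left]
  exact (posDef_PsiR hQ hR hZ).posSemidef.transpose_mul_mul_same _

lemma exists_gainCost_eq_RopR (hQ : Q.PosDef) (hR : R.PosDef) (hZ : Z.PosSemidef) :
    ∃ L, gainCost A Bb C0 Cb σ0 σD Q D R L Z = RopR A Bb C0 Cb σ0 σD Q D R Z :=
  ⟨-((PsiR A Bb C0 Cb σ0 σD Q D R Z)⁻¹ * Bbᵀ * Z * A), by simp [gainCost_eq hQ hR hZ]⟩

/-- The Riccati operator is monotone on the positive semidefinite cone. -/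
lemma RopR_mono (hQ : Q.PosDef) (hR : R.PosDef) (hX : X.PosSemidef) (hY : Y.PosSemidef)
    (h : (Y - X).PosSemidef) :
    (RopR A Bb C0 Cb σ0 σD Q D R Y - RopR A Bb C0 Cb σ0 σD Q D R X).PosSemidef := by
  obtain ⟨L, hL⟩ := exists_gainCost_eq_RopR (A := A) (Bb := Bb) (C0 := C0) (Cb := Cb)
    (σ0 := σ0) (σD := σD) (D := D) hQ hR hY
  rw [← hL]
  rw [← sub_add_sub_cancel _ (gainCost A Bb C0 Cb σ0 σD Q D R L X)]
  exact (gainCost_mono h L).add (RopR_le_gainCost hQ hR hX L)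

lemma le_RopR (hQ : Q.PosDef) (hR : R.PosDef) (hZ : Z.PosSemidef) :
    (RopR A Bb C0 Cb σ0 σD Q D R Z - Q).PosSemidef := by
  obtain ⟨L, hL⟩ := exists_gainCost_eq_RopR (A := A) (Bb := Bb) (C0 := C0) (Cb := Cb)
    (σ0 := σ0) (σD := σD) (D := D) hQ hR hZ
  rw [← hL, gainCost, add_right_comm, add_sub_cancel_right]
  exact (hZ.transpose_mul_mul_same _).add
    ((posDef_PsiR_sub hQ hR hZ).posSemidef.transpose_mul_mul_same L)

lemma continuousAt_RopR (hQ : Q.PosDef) (hR : R.PosDef) (hZ : Z.PosSemidef) :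
    ContinuousAt (RopR A Bb C0 Cb σ0 σD Q D R) Z := by
  have hΨ : Continuous (PsiR A Bb C0 Cb σ0 σD Q D R) := by
    unfold PsiR; fun_prop
  obtain ⟨u, hu⟩ : IsUnit (PsiR A Bb C0 Cb σ0 σD Q D R Z).det :=
    (isUnit_iff_isUnit_det _).1 (posDef_PsiR hQ hR hZ).isUnit
  have hinv : ContinuousAt (fun Z => (PsiR A Bb C0 Cb σ0 σD Q D R Z)⁻¹) Z := by
    refine ContinuousAt.comp (g := Inv.inv) (continuousAt_matrix_inv _ ?_) hΨ.continuousAt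
    rw [← hu]
    exact NormedRing.inverse_continuousAt u
  have hmul : Continuous fun p : Matrix (Fin n) (Fin n) ℝ × Matrix (Fin n) (Fin n) ℝ =>
      Aᵀ * p.1 * A + Q - Aᵀ * p.1 * Bb * p.2 * Bbᵀ * p.1 * A := by
    fun_prop
  exact ContinuousAt.comp (f := fun Z => (Z, (PsiR A Bb C0 Cb σ0 σD Q D R Z)⁻¹))
    hmul.continuousAt (continuousAt_id.prodMk hinv)

end Riccati

/-- monotone iteration, Remark 3.
If `Z_0 ⪰ 0` satisfies `Z_0 ⪰ R^R_D(Z_0)` and `Z_{k+1} = R^R_D(Z_k)`, then the sequence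
`(Z_k)` is nonincreasing in the Loewner order, satisfies `Z_k ⪰ Q > 0` for `k ≥ 1`, and
converges to a positive definite solution `Ẑ = R^R_D(Ẑ)` of the DDARE. -/
theorem stmt_10 {n : ℕ} (A Bb C0 Cb : Matrix (Fin n) (Fin n) ℝ) (hA : IsUnit A.det)
    (σ0 σD : ℝ) (hσ0 : 0 ≤ σ0) (hσD : 0 ≤ σD) (D : ℕ)
    (Q R : Matrix (Fin n) (Fin n) ℝ) (hQ : Q.PosDef) (hR : R.PosDef)
    (Z : ℕ → Matrix (Fin n) (Fin n) ℝ)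
    (hZ0 : (Z 0).PosSemidef)
    (hdom : (Z 0 - RopR A Bb C0 Cb σ0 σD Q D R (Z 0)).PosSemidef)
    (hrec : ∀ k : ℕ, Z (k + 1) = RopR A Bb C0 Cb σ0 σD Q D R (Z k)) :
    (∀ k : ℕ, (Z k - Z (k + 1)).PosSemidef) ∧
    (∀ k : ℕ, 1 ≤ k → (Z k - Q).PosSemidef) ∧
    ∃ Zhat : Matrix (Fin n) (Fin n) ℝ, Zhat.PosDef ∧
      Tendsto Z atTop (nhds Zhat) ∧ Zhat = RopR A Bb C0 Cb σ0 σD Q D R Zhat := by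
  have hpos (k : ℕ) : (Z k).PosSemidef := by
    induction k with
    | zero => exact hZ0
    | succ k ih =>
      rw [hrec]
      simpa using (le_RopR hQ hR ih).add hQ.posSemidef
  have hanti (k : ℕ) : (Z k - Z (k + 1)).PosSemidef := by
    induction k with
    | zero => rwa [hrec]
    | succ k ih =>
      have h := RopR_mono (A := A) (Bb := Bb) (C0 := C0) (Cb := Cb) (σ0 := σ0) (σD := σD)
        (D := D) hQ hR (hpos (k + 1)) (hpos k) ih
      rwa [← hrec, ← hrec] at h
  have hge (k : ℕ) (hk : 1 ≤ k) : (Z k - Q).PosSemidef := by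
    obtain ⟨m, rfl⟩ := Nat.exists_eq_add_of_le' hk
    rw [hrec]
    exact le_RopR hQ hR (hpos m)
  obtain ⟨L, hL⟩ := exists_tendsto_of_posSemidef_antitone hpos hanti
  have hLpsd : L.PosSemidef := posSemidef_of_tendsto hL (.of_forall hpos)
  have hLQ : (L - Q).PosSemidef :=
    posSemidef_of_tendsto (hL.sub_const Q) ((eventually_ge_atTop 1).mono hge)
  refine ⟨hanti, hge, L, by simpa using PosDef.posSemidef_add hLQ hQ, hL, ?_⟩
  refine tendsto_nhds_unique (hL.comp (tendsto_add_atTop_nat 1)) ?_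
  exact ((continuousAt_RopR hQ hR hLpsd).tendsto.comp hL).congr fun k => (hrec k).symm
end
end

section
/- Let Z be symmetric positive semidefinite and Q symmetric positive definite with Z ⪯ A'ZA + Q. Then for any matrix C and any integer D ≥ 0, C'(A')^D Z A^D C - C'(A')^D Q A^D C ⪯ C'(A')^{D+1} Z A^{D+1} C; consequently, with R̂ = R - σ_0² C_0'(A')^D Q A^D C_0, one has Ψ^R_{D+1}(Z) ⪰ Ψ^{R̂}_D(Z). -/
open Matrix

noncomputable section

/-- Reversing the order of summation over `1, …, D`. -/
theorem sum_Icc_one_sub {M : Type*} [AddCommMonoid M] (f : ℕ → M) (D : ℕ) :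
    ∑ h ∈ Finset.Icc 1 D, f (D - h) = ∑ j ∈ Finset.range D, f j := by
  refine Finset.sum_nbij' (fun h => D - h) (fun j => D - j) ?_ ?_ ?_ ?_ ?_ <;>
    simp only [Finset.mem_Icc, Finset.mem_range, implies_true] <;> lia

theorem posSemidef_conj_pow_step {n : ℕ} {A Q Z : Matrix (Fin n) (Fin n) ℝ}
    (hdom : (Aᵀ * Z * A + Q - Z).PosSemidef) (C : Matrix (Fin n) (Fin n) ℝ) (D : ℕ) :
    (Cᵀ * (Aᵀ) ^ (D + 1) * Z * A ^ (D + 1) * C -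
      (Cᵀ * (Aᵀ) ^ D * Z * A ^ D * C - Cᵀ * (Aᵀ) ^ D * Q * A ^ D * C)).PosSemidef := by
  have h := hdom.conjTranspose_mul_mul_same (A ^ D * C)
  rw [conjTranspose_eq_transpose_of_trivial, transpose_mul, transpose_pow] at h
  convert h using 1
  rw [pow_succ (Aᵀ), pow_succ' A]
  noncomm_ring

/-- a monotonicity lemma for the weighting matrices.
If `Z ⪰ 0`, `Q > 0` and `Z ⪯ A'ZA + Q`, then for every matrix `C` and integer `D ≥ 0`,
`C'(A')^D Z A^D C - C'(A')^D Q A^D C ⪯ C'(A')^{D+1} Z A^{D+1} C`; consequently, with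
`R̂ = R - σ_0² C_0'(A')^D Q A^D C_0`, one has `Ψ^R_{D+1}(Z) ⪰ Ψ^{R̂}_D(Z)`. -/
theorem stmt_12 {n : ℕ} (A Bb C0 Cb : Matrix (Fin n) (Fin n) ℝ) (hA : IsUnit A.det)
    (σ0 σD : ℝ) (hσ0 : 0 ≤ σ0) (hσD : 0 ≤ σD)
    (Q R : Matrix (Fin n) (Fin n) ℝ) (hQ : Q.PosDef) (hR : R.PosDef)
    (Z : Matrix (Fin n) (Fin n) ℝ) (hZ : Z.PosSemidef)
    (hdom : (Aᵀ * Z * A + Q - Z).PosSemidef) :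
    (∀ (C : Matrix (Fin n) (Fin n) ℝ) (D : ℕ),
      (Cᵀ * (Aᵀ) ^ (D + 1) * Z * A ^ (D + 1) * C -
        (Cᵀ * (Aᵀ) ^ D * Z * A ^ D * C - Cᵀ * (Aᵀ) ^ D * Q * A ^ D * C)).PosSemidef) ∧
    (∀ D : ℕ,
      (PsiR A Bb C0 Cb σ0 σD Q (D + 1) R Z -
        PsiR A Bb C0 Cb σ0 σD Q D
          (R - σ0 ^ 2 • (C0ᵀ * (Aᵀ) ^ D * Q * A ^ D * C0)) Z).PosSemidef) := by
  refine ⟨posSemidef_conj_pow_step hdom, fun D => ?_⟩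
  convert ((posSemidef_conj_pow_step hdom C0 D).smul (sq_nonneg σ0)).add
    ((posSemidef_conj_pow_step hdom Cb D).smul (sq_nonneg σD)) using 1
  have hsum := sum_Icc_one_sub fun j => σD ^ 2 • (Cbᵀ * (Aᵀ) ^ j * Q * A ^ j * Cb)
  simp only [PsiR, hsum, Finset.sum_range_succ, smul_sub]
  abel
end
end

section
/- Let a, b̄, c, c̄, σ_0, σ_D be real numbers with b̄ ≠ 0, let D ≥ 0 be an integer, and let q > 0, r > 0. Consider the scalar DDARE z = a²z + q - a² b̄² Ψ^{-1} z², where Ψ = (b̄² + σ_0² c² a^{2D} + σ_D² c̄² a^{2D}) z + (r + Σ_{h=1}^{D} σ_D² c̄² a^{2(D-h)} q). This equation, equivalently the quadratic c₂ z² + c₁ z + c₀ = 0 with c₀ = r + Σ_{h=1}^{D} σ_D² c̄² a^{2(D-h)} q > 0, c = b̄² + σ_0² c² a^{2D} + σ_D² c̄² a^{2D}, c₁ = (a² - 1)c₀ + c, and c₂ = (a² - 1)c - a² b̄², has a unique positive solution z > 0 if and only if c₂ < 0, i.e. if and only if a^{2D}(σ_0² c² + σ_D² c̄²)(a² - 1)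 < b̄². -/
/-- A real quadratic with negative leading coefficient and positive constant term has exactly one
positive root. -/
theorem existsUnique_pos_root_of_neg {A B K : ℝ} (hA : A < 0) (hK : 0 < K) :
    ∃! z : ℝ, 0 < z ∧ A * z ^ 2 + B * z + K = 0 := by
  have hAK : A * K < 0 := mul_neg_of_neg_of_pos hA hK
  have hs : √(B ^ 2 - 4 * (A * K)) ^ 2 = B ^ 2 - 4 * (A * K) :=
    Real.sq_sqrt (by nlinarith [sq_nonneg B])
  have hBs : B < √(B ^ 2 - 4 * (A * K)) := Real.lt_sqrt_of_sq_lt (by linarith)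
  set t := √(B ^ 2 - 4 * (A * K)) - B with ht
  have ht0 : 0 < t := sub_pos.mpr hBs
  have htq : t ^ 2 + 2 * B * t + 4 * (A * K) = 0 := by
    rw [ht]; linear_combination hs
  obtain ⟨z, hz, hz'⟩ : ∃ z : ℝ, 0 < z ∧ A * z ^ 2 + B * z + K = 0 := by
    refine ⟨2 * K / t, by positivity, ?_⟩
    field_simp
    linear_combination K * htq
  refine ⟨z, ⟨hz, hz'⟩, fun w ⟨hw, hw'⟩ => ?_⟩
  have h : (w - z) * (K - A * (w * z)) = 0 := by
    linear_combination w * hz' - z * hw'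
  have hpos : K - A * (w * z) ≠ 0 :=
    (sub_pos.mpr ((mul_neg_of_neg_of_pos hA (mul_pos hw hz)).trans hK)).ne'
  exact sub_eq_zero.mp ((mul_eq_zero.mp h).resolve_right hpos)

/-- If nonnegativity of the leading coefficient forces the linear one to be nonnegative, a real
quadratic with positive constant term has a unique positive root iff its leading coefficient is
negative. -/
theorem existsUnique_pos_root_iff_neg {A B K : ℝ} (hK : 0 < K) (hAB : 0 ≤ A → 0 ≤ B) :
    (∃! z : ℝ, 0 < z ∧ A * z ^ 2 + B * z + K = 0) ↔ A < 0 := by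
  refine ⟨fun ⟨z, ⟨hz, h⟩, _⟩ => ?_, fun hA => existsUnique_pos_root_of_neg hA hK⟩
  by_contra! hA
  have hB := hAB hA
  have : 0 < A * z ^ 2 + B * z + K := by positivity
  exact this.ne' h

/-- scalar DDARE / quadratic: unique positive solution criterion.
For the scalar DDARE `z = a²z + q - a²b̄²Ψ⁻¹z²` with
`Ψ(z) = (b̄² + σ₀²c²a^{2D} + σ_D²c̄²a^{2D}) z + (r + Σ_{h=1}^{D} σ_D²c̄²a^{2(D-h)} q)`,
equivalently the quadratic `c₂z² + c₁z + c₀ = 0`, the constant term `c₀` is positive and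
there is a unique positive solution `z > 0` iff `c₂ < 0`, i.e. iff
`a^{2D}(σ₀²c² + σ_D²c̄²)(a² - 1) < b̄²`. -/
theorem stmt_14 (a c cb bb σ0 σD : ℝ) (hb : bb ≠ 0) (D : ℕ)
    (q r : ℝ) (hq : 0 < q) (hr : 0 < r) :
    0 < r + ∑ h ∈ Finset.Icc 1 D, σD ^ 2 * cb ^ 2 * a ^ (2 * (D - h)) * q ∧
    ((∃! z : ℝ, 0 < z ∧
        z = a ^ 2 * z + q - a ^ 2 * bb ^ 2 *
          ((bb ^ 2 + σ0 ^ 2 * c ^ 2 * a ^ (2 * D) + σD ^ 2 * cb ^ 2 * a ^ (2 * D)) * z +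
            (r + ∑ h ∈ Finset.Icc 1 D, σD ^ 2 * cb ^ 2 * a ^ (2 * (D - h)) * q))⁻¹ * z ^ 2) ↔
      ((a ^ 2 - 1) * (bb ^ 2 + σ0 ^ 2 * c ^ 2 * a ^ (2 * D) + σD ^ 2 * cb ^ 2 * a ^ (2 * D)) -
        a ^ 2 * bb ^ 2) < 0) ∧
    ((∃! z : ℝ, 0 < z ∧
        ((a ^ 2 - 1) * (bb ^ 2 + σ0 ^ 2 * c ^ 2 * a ^ (2 * D) + σD ^ 2 * cb ^ 2 * a ^ (2 * D)) -
            a ^ 2 * bb ^ 2) * z ^ 2 +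
          ((a ^ 2 - 1) *
              (r + ∑ h ∈ Finset.Icc 1 D, σD ^ 2 * cb ^ 2 * a ^ (2 * (D - h)) * q) +
            (bb ^ 2 + σ0 ^ 2 * c ^ 2 * a ^ (2 * D) + σD ^ 2 * cb ^ 2 * a ^ (2 * D))) * z +
          (r + ∑ h ∈ Finset.Icc 1 D, σD ^ 2 * cb ^ 2 * a ^ (2 * (D - h)) * q) = 0) ↔
      ((a ^ 2 - 1) * (bb ^ 2 + σ0 ^ 2 * c ^ 2 * a ^ (2 * D) + σD ^ 2 * cb ^ 2 * a ^ (2 * D)) -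
        a ^ 2 * bb ^ 2) < 0) ∧
    (((a ^ 2 - 1) * (bb ^ 2 + σ0 ^ 2 * c ^ 2 * a ^ (2 * D) + σD ^ 2 * cb ^ 2 * a ^ (2 * D)) -
        a ^ 2 * bb ^ 2) < 0 ↔
      a ^ (2 * D) * (σ0 ^ 2 * c ^ 2 + σD ^ 2 * cb ^ 2) * (a ^ 2 - 1) < bb ^ 2) := by
  have hc₀ : 0 < r + ∑ h ∈ Finset.Icc 1 D, σD ^ 2 * cb ^ 2 * a ^ (2 * (D - h)) * q := by
    refine add_pos_of_pos_of_nonneg hr (Finset.sum_nonneg fun h _ => ?_)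
    rw [pow_mul]
    positivity
  have hbb : 0 < bb ^ 2 := by positivity
  have hC : 0 < bb ^ 2 + σ0 ^ 2 * c ^ 2 * a ^ (2 * D) + σD ^ 2 * cb ^ 2 * a ^ (2 * D) := by
    rw [pow_mul]
    positivity
  have hlast : (a ^ 2 - 1) *
        (bb ^ 2 + σ0 ^ 2 * c ^ 2 * a ^ (2 * D) + σD ^ 2 * cb ^ 2 * a ^ (2 * D)) - a ^ 2 * bb ^ 2 =
      a ^ (2 * D) * (σ0 ^ 2 * c ^ 2 + σD ^ 2 * cb ^ 2) * (a ^ 2 - 1) - bb ^ 2 := by ring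
  refine ⟨hc₀, ?_, ?_, by rw [hlast, sub_neg]⟩
  all_goals
    clear hlast
    generalize r + ∑ h ∈ Finset.Icc 1 D, σD ^ 2 * cb ^ 2 * a ^ (2 * (D - h)) * q = c₀ at *
    generalize bb ^ 2 + σ0 ^ 2 * c ^ 2 * a ^ (2 * D) + σD ^ 2 * cb ^ 2 * a ^ (2 * D) = C at *
    have ha (h : 0 ≤ (a ^ 2 - 1) * C - a ^ 2 * bb ^ 2) : 0 ≤ a ^ 2 - 1 :=
      nonneg_of_mul_nonneg_left (by nlinarith [mul_nonneg (sq_nonneg a) hbb.le]) hC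
  · rw [← existsUnique_pos_root_iff_neg (B := (a ^ 2 - 1) * c₀ + q * C) (mul_pos hq hc₀)
      fun h => add_nonneg (mul_nonneg (ha h) hc₀.le) (mul_pos hq hC).le]
    refine existsUnique_congr fun z => and_congr_right fun hz => ?_
    have hΨ : C * z + c₀ ≠ 0 := by positivity
    rw [← sub_eq_zero, ← mul_eq_zero_iff_right hΨ, ← neg_eq_zero]
    refine Eq.congr_left ?_
    field_simp
    ring
  · exact existsUnique_pos_root_iff_neg hc₀
      fun h => add_nonneg (mul_nonneg (ha h) hc₀.le) hC.le
end
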